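/- Under the stated assumptions, there exist finite positive constants C, c₁, c₂ (independent of n and δ) such that for every δ > 0 and every n, P( b_n^{−1} |R_0(n)| > δ ) ≤ 2C exp( − 3δ² b_n² |G_n| / (2 (c₂ δ b_n |G_n|^{1/2} h_n^{−d/2} + 3 c₁ |G_{n−p_n}|)) ). -/

import Mathlib

open MeasureTheory Filter ProbabilityTheory

noncomputable section

namespace BMC

/-- A vertex of the infinite binary tree is a finite word over `{0,1}`. -/
abbrev Word : Type := List Bool

/-- The `k`-th generation `G_k` of the binary tree. -/
def gen (k : ℕ) : Finset Word :=
  (Finset.univ : Finset (Fin k → Bool)).image fun f => List.ofFn f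

/-- The tree `T_k` up to generation `k`. -/
def tree (k : ℕ) : Finset Word := (Finset.range (k + 1)).biUnion gen

/-- The (lexicographic-genealogic) order on the binary tree: `i ≤ j` iff `i` is an
ancestor of `j`, or `v0` is an ancestor of `i` and `v1` an ancestor of `j` for some `v`. -/
def wle (i j : Word) : Prop :=
  i <+: j ∨ ∃ v : Word, (v ++ [false]) <+: i ∧ (v ++ [true]) <+: j

variable {d : ℕ}

/-- Euclidean norm on `Fin d → ℝ`. -/
def enorm (x : Fin d → ℝ) : ℝ := Real.sqrt (∑ j, x j ^ 2)

/-- Action of the kernel `P` on a function of the pair of children. -/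
def Pop (P : Kernel (Fin d → ℝ) ((Fin d → ℝ) × (Fin d → ℝ)))
    (h : (Fin d → ℝ) × (Fin d → ℝ) → ℝ) (x : Fin d → ℝ) : ℝ := ∫ p, h p ∂(P x)

/-- The mean kernel `Q = (P₀ + P₁)/2`, acting on functions. -/
def Qop (P : Kernel (Fin d → ℝ) ((Fin d → ℝ) × (Fin d → ℝ)))
    (f : (Fin d → ℝ) → ℝ) : (Fin d → ℝ) → ℝ :=
  fun x => (∫ p, (f p.1 + f p.2) ∂(P x)) / 2

/-- The σ-field generated by the chain up to generation `k`. -/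
def sigmaUpTo {Ω : Type*} [MeasurableSpace Ω] (X : Word → Ω → (Fin d → ℝ)) (k : ℕ) :
    MeasurableSpace Ω :=
  ⨆ j ∈ tree k, MeasurableSpace.comap (X j) inferInstance

/-- The σ-field `F_i` generated by `X_u` for `u ≤ i` in the tree order. -/
def Fsig {Ω : Type*} [MeasurableSpace Ω] (X : Word → Ω → (Fin d → ℝ)) (i : Word) :
    MeasurableSpace Ω :=
  ⨆ u ∈ {u : Word | wle u i}, MeasurableSpace.comap (X u) inferInstance

/-- `X` is a bifurcating Markov chain with initial distribution `ν` and kernel `P`. -/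
structure IsBMC {Ω : Type*} [MeasurableSpace Ω] (Pr : Measure Ω)
    (X : Word → Ω → (Fin d → ℝ)) (ν : Measure (Fin d → ℝ))
    (P : Kernel (Fin d → ℝ) ((Fin d → ℝ) × (Fin d → ℝ))) : Prop where
  meas : ∀ i, Measurable (X i)
  init : Pr.map (X []) = ν
  branching : ∀ (k : ℕ) (g : Word → (Fin d → ℝ) → (Fin d → ℝ) → (Fin d → ℝ) → ℝ),
    (∀ i, Measurable fun p : (Fin d → ℝ) × (Fin d → ℝ) × (Fin d → ℝ) => g i p.1 p.2.1 p.2.2) →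
    (∀ i, ∃ C, ∀ x y z, |g i x y z| ≤ C) →
    (Pr[(fun ω => ∏ i ∈ gen k, g i (X i ω) (X (i ++ [false]) ω) (X (i ++ [true]) ω))
        | sigmaUpTo X k]
      =ᵐ[Pr] fun ω => ∏ i ∈ gen k, ∫ p, g i (X i ω) p.1 p.2 ∂(P (X i ω)))

/-- Uniform geometric ergodicity of `Q` with invariant measure `μm`, rate `α`, constant `M`. -/
def ErgodicQ (P : Kernel (Fin d → ℝ) ((Fin d → ℝ) × (Fin d → ℝ)))
    (μm : Measure (Fin d → ℝ)) (M α : ℝ) : Prop :=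
  ∀ (f : (Fin d → ℝ) → ℝ) (C : ℝ), Measurable f → (∀ x, |f x| ≤ C) →
    ∀ (n : ℕ) (x : Fin d → ℝ), |(Qop P)^[n] f x - ∫ y, f y ∂μm| ≤ M * α ^ n * C

/-- `μm` is invariant for `Q`. -/
def IsInvariantQ (P : Kernel (Fin d → ℝ) ((Fin d → ℝ) × (Fin d → ℝ)))
    (μm : Measure (Fin d → ℝ)) : Prop :=
  ∀ f : (Fin d → ℝ) → ℝ, Measurable f → (∃ C, ∀ x, |f x| ≤ C) →
    ∫ x, Qop P f x ∂μm = ∫ x, f x ∂μm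

/-- The bandwidth `h_n = 2^{-nγ}`. -/
def bandwidth (γ : ℝ) (n : ℕ) : ℝ := (2 : ℝ) ^ (-(n : ℝ) * γ)

/-- The kernel density estimator `μ̂_{A}(x)` built from observations indexed by `A`. -/
def est {Ω : Type*} (K : (Fin d → ℝ) → ℝ) (X : Word → Ω → (Fin d → ℝ)) (γ : ℝ)
    (A : Finset Word) (n : ℕ) (x : Fin d → ℝ) (ω : Ω) : ℝ :=
  (A.card : ℝ)⁻¹ * (bandwidth γ n ^ (d : ℝ))⁻¹ *
    ∑ u ∈ A, K ((bandwidth γ n)⁻¹ • (x - X u ω))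

/-- One-dimensional `k`-th partial derivative of `f` in direction `j` at `x`. -/
def pder (f : (Fin d → ℝ) → ℝ) (j : Fin d) (k : ℕ) (x : Fin d → ℝ) : ℝ :=
  iteratedDeriv k (fun t => f (Function.update x j t)) (x j)

/-- `f` belongs to the isotropic Hölder class of order `s` with constant `L`. -/
def HolderClass (f : (Fin d → ℝ) → ℝ) (s L : ℝ) : Prop :=
  (∀ (j : Fin d) (x : Fin d → ℝ),
      ContDiff ℝ (⌊s⌋₊ : ℕ∞) fun t => f (Function.update x j t)) ∧
  ∀ (j : Fin d) (x : Fin d → ℝ) (t : ℝ),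
    |pder f j ⌊s⌋₊ (Function.update x j t) - pder f j ⌊s⌋₊ x| ≤
      L * |x j - t| ^ (s - (⌊s⌋₊ : ℝ))

/-- Regularity of the kernel function `K`. -/
def KernelReg (K : (Fin d → ℝ) → ℝ) : Prop :=
  Measurable K ∧ (∃ C, ∀ x, |K x| ≤ C) ∧ Integrable K volume ∧
    Integrable (fun x => K x ^ 2) volume ∧ (∫ x, K x) = 1 ∧
    ∀ ε > 0, ∃ R, ∀ x, R ≤ enorm x → |enorm x * K x| < ε

/-- `K` is of order `⌊s⌋`. -/
def KernelOrder (K : (Fin d → ℝ) → ℝ) (s : ℝ) : Prop :=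
  Integrable (fun x => enorm x ^ s * |K x|) volume ∧
    ∀ (j : Fin d) (k : ℕ), 1 ≤ k → k ≤ ⌊s⌋₊ →
      ∀ x : Fin d → ℝ, (∫ t : ℝ, t ^ k * K (Function.update x j t)) = 0

/-- Conditions (2.7) on the moderate deviation speed `b_n`. -/
def SpeedCond (b : ℕ → ℝ) (γ s : ℝ) (d : ℕ) : Prop :=
  (∀ n, 0 < b n) ∧ Tendsto b atTop atTop ∧
    Tendsto (fun n : ℕ => (n : ℝ) ^ (3 / 2 : ℝ) * b n /
      Real.sqrt (2 ^ n * bandwidth γ n ^ (d : ℝ))) atTop (nhds 0) ∧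
    Tendsto (fun n => b n /
      Real.sqrt (2 ^ n * bandwidth γ n ^ (2 * s + d))) atTop atTop

/-- `W` satisfies a moderate deviation principle with speed `b_n²` and rate function `I`. -/
def MDPseq {E Ω : Type*} [TopologicalSpace E] [MeasurableSpace E] [MeasurableSpace Ω]
    (Pr : Measure Ω) (W : ℕ → Ω → E) (b : ℕ → ℝ) (I : E → ℝ) : Prop :=
  ∀ A : Set E, MeasurableSet A →
    (-(⨅ y ∈ interior A, (I y : EReal)) ≤
      Filter.liminf
        (fun n => (((b n ^ 2)⁻¹ : ℝ) : EReal) * ENNReal.log (Pr {ω | W n ω ∈ A})) atTop) ∧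
    Filter.limsup
        (fun n => (((b n ^ 2)⁻¹ : ℝ) : EReal) * ENNReal.log (Pr {ω | W n ω ∈ A})) atTop ≤
      -(⨅ y ∈ closure A, (I y : EReal))

/-- `f` centered with respect to `μm`. -/
def tilde (μm : Measure (Fin d → ℝ)) (f : (Fin d → ℝ) → ℝ) (x : Fin d → ℝ) : ℝ :=
  f x - ∫ y, f y ∂μm

/-- `M_A(f) = Σ_{i ∈ A} f(X_i)`. -/
def MA {Ω : Type*} (X : Word → Ω → (Fin d → ℝ)) (A : Finset Word)
    (f : (Fin d → ℝ) → ℝ) (ω : Ω) : ℝ :=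
  ∑ i ∈ A, f (X i ω)

/-- Assumption 2.4 on the sequence of functions `𝔣_n = (f_{ℓ,n})`, where `f n ℓ = f_{ℓ,n}`. -/
def FnAssump (P : Kernel (Fin d → ℝ) ((Fin d → ℝ) × (Fin d → ℝ)))
    (μm : Measure (Fin d → ℝ)) (γ : ℝ) (f : ℕ → ℕ → (Fin d → ℝ) → ℝ) (σ2 : ℝ) : Prop :=
  (∀ n ℓ, Measurable (f n ℓ)) ∧
  (∀ n ℓ, n < ℓ → f n ℓ = 0) ∧
  (∃ C : ℝ, ∀ n : ℕ, ∀ ℓ ≤ n,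
    (∀ x, bandwidth γ n ^ ((d : ℝ) / 2) * |f n ℓ x| ≤ C) ∧
    (∀ x, |Qop P (f n ℓ) x| ≤ C * bandwidth γ n ^ ((d : ℝ) / 2)) ∧
    (∀ x, |Qop P (fun y => f n ℓ y ^ 2) x| ≤ C) ∧
    (∀ x, |Pop P (fun q => f n ℓ q.1 * f n ℓ q.2) x| ≤ C * bandwidth γ n ^ (d : ℝ))) ∧
  (∃ C : ℝ, ∀ n : ℕ, ∀ ℓ ≤ n,
    (∫ x, |f n ℓ x| ∂μm) ≤ C * bandwidth γ n ^ ((d : ℝ) / 2) ∧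
    (∫ x, f n ℓ x ^ 2 ∂μm) ≤ C) ∧
  Tendsto (fun n => ∑ ℓ ∈ Finset.range (n + 1), ((2 : ℝ)⁻¹) ^ ℓ * ∫ x, f n ℓ x ^ 2 ∂μm)
    atTop (nhds σ2)

/-- `N_{n,∅}(𝔣_n)`. -/
def Nempty {Ω : Type*} (X : Word → Ω → (Fin d → ℝ)) (μm : Measure (Fin d → ℝ))
    (f : ℕ → ℕ → (Fin d → ℝ) → ℝ) (n : ℕ) (ω : Ω) : ℝ :=
  (Real.sqrt (2 ^ n))⁻¹ * ∑ ℓ ∈ Finset.range (n + 1), MA X (gen (n - ℓ)) (tilde μm (f n ℓ)) ω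

/-- Conditions on the auxiliary sequence `p_n`. -/
def PCond (p : ℕ → ℕ) (b : ℕ → ℝ) : Prop :=
  Monotone p ∧ (∀ n, 1 ≤ p n) ∧ (∀ n, 1 ≤ n → p n ≤ n) ∧
    Tendsto (fun n => (p n : ℝ) ^ 3 * b n ^ 2 / 2 ^ (n - p n : ℕ)) atTop (nhds 0)

/-- `N_{n,i}(𝔣_n)` for `i ∈ G_{n-p_n}`. -/
def Nni {Ω : Type*} (X : Word → Ω → (Fin d → ℝ)) (μm : Measure (Fin d → ℝ))
    (f : ℕ → ℕ → (Fin d → ℝ) → ℝ) (p : ℕ → ℕ) (n : ℕ) (i : Word) (ω : Ω) : ℝ :=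
  (Real.sqrt (2 ^ n))⁻¹ * ∑ ℓ ∈ Finset.range (p n + 1),
    ∑ j ∈ gen (p n - ℓ), tilde μm (f n ℓ) (X (i ++ j) ω)

/-- The martingale increment `Δ_{n,i}(𝔣_n)`. -/
def Dni {Ω : Type*} [MeasurableSpace Ω] (Pr : Measure Ω) (X : Word → Ω → (Fin d → ℝ))
    (μm : Measure (Fin d → ℝ)) (f : ℕ → ℕ → (Fin d → ℝ) → ℝ) (p : ℕ → ℕ)
    (n : ℕ) (i : Word) (ω : Ω) : ℝ :=
  Nni X μm f p n i ω - (Pr[Nni X μm f p n i | Fsig X i]) ω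

/-- Bounded measurable real functions. -/
def BddMeasurable {E : Type*} [MeasurableSpace E] (f : E → ℝ) : Prop :=
  Measurable f ∧ ∃ C, ∀ x, |f x| ≤ C

namespace BddMeasurable

variable {E F : Type*} [MeasurableSpace E] [MeasurableSpace F] {f g : E → ℝ}

lemma const (c : ℝ) : BddMeasurable fun _ : E => c :=
  ⟨measurable_const, |c|, fun _ => le_rfl⟩

lemma add (hf : BddMeasurable f) (hg : BddMeasurable g) : BddMeasurable fun x => f x + g x := by
  obtain ⟨hf, C, hC⟩ := hf
  obtain ⟨hg, D, hD⟩ := hg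
  exact ⟨hf.add hg, C + D, fun x => (abs_add_le _ _).trans (add_le_add (hC x) (hD x))⟩

lemma mul (hf : BddMeasurable f) (hg : BddMeasurable g) : BddMeasurable fun x => f x * g x := by
  obtain ⟨hf, C, hC⟩ := hf
  obtain ⟨hg, D, hD⟩ := hg
  refine ⟨hf.mul hg, C * D, fun x => ?_⟩
  rw [abs_mul]
  exact mul_le_mul (hC x) (hD x) (abs_nonneg _) ((abs_nonneg _).trans (hC x))

lemma const_mul (c : ℝ) (hf : BddMeasurable f) : BddMeasurable fun x => c * f x :=
  (const c).mul hf

lemma sub (hf : BddMeasurable f) (hg : BddMeasurable g) : BddMeasurable fun x => f x - g x := by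
  simpa [sub_eq_add_neg] using hf.add (hg.const_mul (-1))

lemma sq (hf : BddMeasurable f) : BddMeasurable fun x => f x ^ 2 := by
  simpa [pow_two] using hf.mul hf

lemma exp (hf : BddMeasurable f) : BddMeasurable fun x => Real.exp (f x) := by
  obtain ⟨hf, C, hC⟩ := hf
  refine ⟨hf.exp, Real.exp C, fun x => ?_⟩
  rw [Real.abs_exp]
  exact Real.exp_le_exp.2 ((le_abs_self _).trans (hC x))

lemma sum {ι : Type*} {s : Finset ι} {f : ι → E → ℝ} (hf : ∀ i ∈ s, BddMeasurable (f i)) :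
    BddMeasurable fun x => ∑ i ∈ s, f i x := by
  classical
  induction s using Finset.induction_on with
  | empty => simpa using const 0
  | insert a s ha ih =>
    simp only [Finset.sum_insert ha]
    exact (hf a (Finset.mem_insert_self a s)).add
      (ih fun i hi => hf i (Finset.mem_insert_of_mem hi))

lemma prod {ι : Type*} {s : Finset ι} {f : ι → E → ℝ} (hf : ∀ i ∈ s, BddMeasurable (f i)) :
    BddMeasurable fun x => ∏ i ∈ s, f i x := by
  classical
  induction s using Finset.induction_on with
  | empty => simpa using const 1
  | insert a s ha ih =>
    simp only [Finset.prod_insert ha]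
    exact (hf a (Finset.mem_insert_self a s)).mul
      (ih fun i hi => hf i (Finset.mem_insert_of_mem hi))

lemma comp (hf : BddMeasurable f) {u : F → E} (hu : Measurable u) :
    BddMeasurable fun x => f (u x) := by
  obtain ⟨hf, C, hC⟩ := hf
  exact ⟨hf.comp hu, C, fun x => hC _⟩

lemma integrable (hf : BddMeasurable f) (μ : Measure E) [IsFiniteMeasure μ] :
    Integrable f μ := by
  obtain ⟨hf, C, hC⟩ := hf
  exact Integrable.of_bound hf.aestronglyMeasurable C (ae_of_all _ hC)

lemma pair (hf : BddMeasurable f) : BddMeasurable fun q : E × E => f q.1 + f q.2 :=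
  (hf.comp measurable_fst).add (hf.comp measurable_snd)

end BddMeasurable

section MeanKernel

variable (P : Kernel (Fin d → ℝ) ((Fin d → ℝ) × (Fin d → ℝ))) {f g : (Fin d → ℝ) → ℝ}

lemma Qop_const_mul (c : ℝ) (x : Fin d → ℝ) :
    Qop P (fun y => c * f y) x = c * Qop P f x := by
  simp only [Qop, ← mul_add, integral_const_mul, mul_div_assoc]

variable [IsMarkovKernel P]

lemma abs_Qop_le {C : ℝ} (hC : ∀ x, |f x| ≤ C) (x : Fin d → ℝ) : |Qop P f x| ≤ C := by
  have h : ‖∫ q, (f q.1 + f q.2) ∂(P x)‖ ≤ 2 * C * (P x).real Set.univ :=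
    norm_integral_le_of_norm_le_const (ae_of_all _ fun q =>
      (abs_add_le _ _).trans (by linarith [hC q.1, hC q.2]))
  rw [probReal_univ, mul_one, Real.norm_eq_abs] at h
  rw [Qop, abs_div, abs_two]
  linarith

lemma BddMeasurable.Qop (hf : BddMeasurable f) : BddMeasurable (Qop P f) := by
  obtain ⟨C, hC⟩ := hf.2
  have hm : StronglyMeasurable fun x => ∫ q, (f q.1 + f q.2) ∂(P x) :=
    hf.pair.1.stronglyMeasurable.integral_kernel
  exact ⟨hm.measurable.div_const 2, C, abs_Qop_le P hC⟩

lemma BddMeasurable.Qop_iterate (hf : BddMeasurable f) (j : ℕ) :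
    BddMeasurable ((BMC.Qop P)^[j] f) := by
  induction j with
  | zero => exact hf
  | succ j ih =>
    rw [Function.iterate_succ_apply']
    exact ih.Qop P

lemma Qop_add (hf : BddMeasurable f) (hg : BddMeasurable g) (x : Fin d → ℝ) :
    Qop P (fun y => f y + g y) x = Qop P f x + Qop P g x := by
  simp only [Qop]
  rw [← add_div, ← integral_add (hf.pair.integrable _) (hg.pair.integrable _)]
  congr 2 with q
  ring

lemma Qop_const (c : ℝ) (x : Fin d → ℝ) : Qop P (fun _ => c) x = c := by
  simp [Qop]

lemma Qop_sum {ι : Type*} {s : Finset ι} {f : ι → (Fin d → ℝ) → ℝ}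
    (hf : ∀ i ∈ s, BddMeasurable (f i)) (x : Fin d → ℝ) :
    Qop P (fun y => ∑ i ∈ s, f i y) x = ∑ i ∈ s, Qop P (f i) x := by
  classical
  induction s using Finset.induction_on with
  | empty => simpa using Qop_const P 0 x
  | insert a s ha ih =>
    simp only [Finset.sum_insert ha]
    have hs : ∀ i ∈ s, BddMeasurable (f i) := fun i hi => hf i (Finset.mem_insert_of_mem hi)
    rw [Qop_add P (hf a (Finset.mem_insert_self a s)) (.sum hs), ih hs]

lemma Qop_mono (hf : BddMeasurable f) (hg : BddMeasurable g) (h : ∀ x, f x ≤ g x)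
    (x : Fin d → ℝ) : Qop P f x ≤ Qop P g x := by
  have := integral_mono (hf.pair.integrable (P x)) (hg.pair.integrable (P x))
    fun q => add_le_add (h q.1) (h q.2)
  exact div_le_div_of_nonneg_right this zero_le_two

/-- Exponential moment bound for the centered sum over two siblings. -/
lemma integral_exp_sibling_le {B w lam : ℝ} (hf : BddMeasurable f) (hB : ∀ x, |f x| ≤ B)
    (hw : ∀ x, Qop P (fun y => f y ^ 2) x ≤ w) (hlam : |lam| * (4 * B) ≤ 1) (x : Fin d → ℝ) :
    ∫ q, Real.exp (lam * (f q.1 + f q.2 - 2 * Qop P f x)) ∂(P x) ≤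
      Real.exp (lam ^ 2 * (4 * w)) := by
  set e := 2 * Qop P f x with he
  have hmean : ∫ q, (f q.1 + f q.2) ∂(P x) = e := by simp only [he, Qop]; ring
  have hZ := hf.pair
  have hY : BddMeasurable fun q : (Fin d → ℝ) × (Fin d → ℝ) => f q.1 + f q.2 - e :=
    hZ.sub (.const e)
  have hsmall : ∀ q : (Fin d → ℝ) × (Fin d → ℝ), |lam * (f q.1 + f q.2 - e)| ≤ 1 := by
    intro q
    rw [abs_mul]
    refine (mul_le_mul_of_nonneg_left ?_ (abs_nonneg _)).trans hlam
    have h1 := abs_le.1 (hB q.1)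
    have h2 := abs_le.1 (hB q.2)
    have h3 := abs_le.1 (abs_Qop_le P hB x)
    rw [abs_le, he]
    constructor <;> linarith [h1.1, h1.2, h2.1, h2.2, h3.1, h3.2]
  have hvar : ∫ q, (f q.1 + f q.2 - e) ^ 2 ∂(P x) ≤ 4 * w := by
    have hexp : ∀ q : (Fin d → ℝ) × (Fin d → ℝ), (f q.1 + f q.2 - e) ^ 2 ≤
        2 * (f q.1 ^ 2 + f q.2 ^ 2) - 2 * e * (f q.1 + f q.2) + e ^ 2 := fun q => by
      nlinarith [sq_nonneg (f q.1 - f q.2)]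
    have h2 := hf.sq.pair
    have hsq : ∫ q, (f q.1 ^ 2 + f q.2 ^ 2) ∂(P x) = 2 * Qop P (fun y => f y ^ 2) x := by
      simp only [Qop]; ring
    have hA : BddMeasurable fun q : (Fin d → ℝ) × (Fin d → ℝ) =>
      2 * (f q.1 ^ 2 + f q.2 ^ 2) - 2 * e * (f q.1 + f q.2) :=
      (h2.const_mul 2).sub (hZ.const_mul (2 * e))
    refine (integral_mono (hY.sq.integrable _) ((hA.add (.const (e ^ 2))).integrable _)
      hexp).trans ?_
    rw [integral_add (hA.integrable _) ((BddMeasurable.const _).integrable _),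
      integral_sub ((h2.const_mul 2).integrable _) ((hZ.const_mul (2 * e)).integrable _),
      integral_const_mul, integral_const_mul, hsq, hmean]
    simp only [integral_const, probReal_univ, one_smul]
    nlinarith [hw x, sq_nonneg e]
  have hpt : ∀ q : (Fin d → ℝ) × (Fin d → ℝ), Real.exp (lam * (f q.1 + f q.2 - e)) ≤
      1 + lam * (f q.1 + f q.2 - e) + lam ^ 2 * (f q.1 + f q.2 - e) ^ 2 := fun q => by
    have := (abs_le.1 (Real.abs_exp_sub_one_sub_id_le (hsmall q))).2
    nlinarith
  have hlin : BddMeasurable fun q : (Fin d → ℝ) × (Fin d → ℝ) =>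
    1 + lam * (f q.1 + f q.2 - e) := (BddMeasurable.const 1).add (hY.const_mul lam)
  have hquad := hY.sq.const_mul (lam ^ 2)
  calc ∫ q, Real.exp (lam * (f q.1 + f q.2 - e)) ∂(P x)
      ≤ ∫ q, (1 + lam * (f q.1 + f q.2 - e) + lam ^ 2 * (f q.1 + f q.2 - e) ^ 2) ∂(P x) :=
        integral_mono ((hY.const_mul lam).exp.integrable _)
          ((hlin.add hquad).integrable _) hpt
    _ = 1 + lam ^ 2 * ∫ q, (f q.1 + f q.2 - e) ^ 2 ∂(P x) := by
        rw [integral_add (hlin.integrable _) (hquad.integrable _),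
          integral_add ((BddMeasurable.const _).integrable _)
            ((hY.const_mul lam).integrable _), integral_const_mul, integral_const_mul,
          integral_sub (hZ.integrable _) ((BddMeasurable.const _).integrable _), hmean]
        simp
    _ ≤ lam ^ 2 * (4 * w) + 1 := by
        nlinarith [mul_le_mul_of_nonneg_left hvar (sq_nonneg lam)]
    _ ≤ Real.exp (lam ^ 2 * (4 * w)) := Real.add_one_le_exp _

end MeanKernel

section Tree

lemma mem_gen {k : ℕ} {w : Word} : w ∈ gen k ↔ w.length = k := by
  constructor
  · intro h
    obtain ⟨u, -, rfl⟩ := Finset.mem_image.1 h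
    exact List.length_ofFn
  · rintro rfl
    exact Finset.mem_image.2 ⟨w.get, Finset.mem_univ _, List.ofFn_get w⟩

lemma card_gen (k : ℕ) : (gen k).card = 2 ^ k := by
  rw [gen, Finset.card_image_of_injective _ List.ofFn_injective]
  simp

lemma gen_zero : gen 0 = {[]} := by
  ext w
  simp [mem_gen]

lemma sum_gen_succ (k : ℕ) (F : Word → ℝ) :
    ∑ i ∈ gen (k + 1), F i = ∑ i ∈ gen k, (F (i ++ [false]) + F (i ++ [true])) := by
  have hunion : gen (k + 1) =
      (gen k).image (fun i => i ++ [false]) ∪ (gen k).image (fun i => i ++ [true]) := by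
    ext w
    simp only [mem_gen, Finset.mem_union, Finset.mem_image]
    constructor
    · intro hw
      have hne : w ≠ [] := by rintro rfl; simp at hw
      have hlen : w.dropLast.length = k := by simp [hw]
      have hsplit := List.dropLast_append_getLast hne
      cases hb : w.getLast hne with
      | false => exact .inl ⟨w.dropLast, hlen, by rwa [hb] at hsplit⟩
      | true => exact .inr ⟨w.dropLast, hlen, by rwa [hb] at hsplit⟩
    · rintro (⟨v, hv, rfl⟩ | ⟨v, hv, rfl⟩) <;> simp [hv]
  have hdisj : Disjoint ((gen k).image fun i => i ++ [false])
      ((gen k).image fun i => i ++ [true]) := by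
    rw [Finset.disjoint_left]
    simp only [Finset.mem_image]
    rintro w ⟨v, -, rfl⟩ ⟨u, -, hu⟩
    simpa using (List.append_inj' hu rfl).2
  rw [hunion, Finset.sum_union hdisj, Finset.sum_image fun _ _ _ _ h => List.append_cancel_right h,
    Finset.sum_image fun _ _ _ _ h => List.append_cancel_right h, Finset.sum_add_distrib]

lemma gen_subset_tree {k r : ℕ} (h : k ≤ r) : gen k ⊆ tree r := fun _ hi =>
  Finset.mem_biUnion.2 ⟨k, Finset.mem_range.2 (by omega), hi⟩

end Tree

section ExponentialMoment

variable {Ω : Type*} [mΩ : MeasurableSpace Ω] {Pr : Measure Ω} [IsProbabilityMeasure Pr]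
  {X : Word → Ω → (Fin d → ℝ)} {ν : Measure (Fin d → ℝ)}
  {P : Kernel (Fin d → ℝ) ((Fin d → ℝ) × (Fin d → ℝ))}

lemma sigmaUpTo_le (hX : ∀ i, Measurable (X i)) (k : ℕ) : sigmaUpTo X k ≤ mΩ :=
  iSup₂_le fun i _ => (hX i).comap_le

lemma measurable_sigmaUpTo {k : ℕ} {i : Word} (hi : i ∈ tree k) :
    Measurable[sigmaUpTo X k] (X i) :=
  Measurable.of_comap_le (le_iSup₂ (f := fun j (_ : j ∈ tree k) =>
    MeasurableSpace.comap (X j) inferInstance) i hi)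

lemma measurable_MA_sigmaUpTo {k r : ℕ} (h : k ≤ r) {f : (Fin d → ℝ) → ℝ} (hf : Measurable f) :
    Measurable[sigmaUpTo X r] (MA X (gen k) f) :=
  Finset.measurable_fun_sum _ fun _ hi =>
    hf.comp (measurable_sigmaUpTo (gen_subset_tree h hi))

lemma BddMeasurable.MA (hX : ∀ i, Measurable (X i)) {f : (Fin d → ℝ) → ℝ}
    (hf : BddMeasurable f) (A : Finset Word) : BddMeasurable (MA X A f) :=
  .sum fun i _ => hf.comp (hX i)

/-- One step of the branching property, integrated against a nonnegative function of the past. -/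
lemma IsBMC.integral_mul_prod_le (hX : IsBMC Pr X ν P) (k : ℕ) {A : Ω → ℝ}
    (hAm : Measurable[sigmaUpTo X k] A) (hA : BddMeasurable A) (hA0 : ∀ ω, 0 ≤ A ω)
    {g : (Fin d → ℝ) × (Fin d → ℝ) × (Fin d → ℝ) → ℝ} (hg : BddMeasurable g)
    (hg0 : ∀ q, 0 ≤ g q) {K : ℝ} (hK : ∀ x, ∫ q, g (x, q.1, q.2) ∂(P x) ≤ K) :
    ∫ ω, A ω * ∏ i ∈ gen k, g (X i ω, X (i ++ [false]) ω, X (i ++ [true]) ω) ∂Pr ≤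
      K ^ 2 ^ k * ∫ ω, A ω ∂Pr := by
  have hm := sigmaUpTo_le hX.meas k
  set Z : Ω → ℝ := fun ω => ∏ i ∈ gen k, g (X i ω, X (i ++ [false]) ω, X (i ++ [true]) ω)
  have hZ : BddMeasurable Z := .prod fun i _ => hg.comp
    ((hX.meas i).prodMk ((hX.meas _).prodMk (hX.meas _)))
  obtain ⟨C, hC⟩ := hA.2
  have hpull : Pr[A * Z | sigmaUpTo X k] =ᵐ[Pr] A * Pr[Z | sigmaUpTo X k] :=
    condExp_mul_of_stronglyMeasurable_left hAm.stronglyMeasurable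
      ((hA.mul hZ).integrable Pr) (hZ.integrable Pr)
  have hbranch := hX.branching k (fun _ x y z => g (x, y, z)) (fun _ => hg.1)
    (fun _ => hg.2.imp fun C hC x y z => hC _)
  have hint : Integrable (A * Pr[Z | sigmaUpTo X k]) Pr := integrable_condExp.congr hpull
  calc ∫ ω, A ω * Z ω ∂Pr = ∫ ω, (Pr[A * Z | sigmaUpTo X k]) ω ∂Pr :=
        (integral_condExp hm).symm
    _ = ∫ ω, (A * Pr[Z | sigmaUpTo X k]) ω ∂Pr := integral_congr_ae hpull
    _ ≤ ∫ ω, K ^ 2 ^ k * A ω ∂Pr := by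
        refine integral_mono_ae hint ((hA.const_mul _).integrable Pr) ?_
        filter_upwards [hbranch] with ω hω
        rw [Pi.mul_apply, mul_comm]
        refine mul_le_mul_of_nonneg_right ?_ (hA0 ω)
        refine (le_of_eq hω).trans ?_
        rw [← card_gen k]
        exact (Finset.prod_le_prod (fun i _ => integral_nonneg fun q => hg0 _)
          fun i _ => hK _).trans_eq (Finset.prod_const K)
    _ = K ^ 2 ^ k * ∫ ω, A ω ∂Pr := integral_const_mul _ _

variable [IsMarkovKernel P]

/-- Exponential moments of an additive functional over the first `m` generations whose summands
`φ k` are compensated by a solution `G` of the Poisson-type recursion `G r = φ r + 2 Q G (r+1)`. -/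
lemma IsBMC.integral_exp_sum_MA_le (hX : IsBMC Pr X ν P) {φ G : ℕ → (Fin d → ℝ) → ℝ} {m : ℕ}
    (hφ : ∀ k, BddMeasurable (φ k)) (hG : ∀ r, BddMeasurable (G r))
    (hrec : ∀ r < m, ∀ x, G r x = φ r x + 2 * Qop P (G (r + 1)) x) (hGm : ∀ x, G m x = 0)
    {B lam : ℝ} {w : ℕ → ℝ} (hB : ∀ r x, |G r x| ≤ B)
    (hw : ∀ r x, Qop P (fun y => G r y ^ 2) x ≤ w r) (hlam : |lam| * (4 * B) ≤ 1) :
    ∫ ω, Real.exp (lam * ∑ k ∈ Finset.range m, MA X (gen k) (φ k) ω) ∂Pr ≤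
      Real.exp (lam ^ 2 * ∑ r ∈ Finset.range m, 2 ^ r * (4 * w (r + 1)) + |lam| * B) := by
  set Φ : ℕ → Ω → ℝ := fun r ω =>
    ∑ k ∈ Finset.range r, MA X (gen k) (φ k) ω + MA X (gen r) (G r) ω with hΦ
  have hΦb : ∀ r, BddMeasurable (Φ r) := fun r =>
    (BddMeasurable.sum fun k _ => (hφ k).MA hX.meas _).add ((hG r).MA hX.meas _)
  have hΦm : ∀ r, Measurable[sigmaUpTo X r] (Φ r) := fun r =>
    (Finset.measurable_fun_sum _ fun k hk =>
      measurable_MA_sigmaUpTo (Finset.mem_range.1 hk).le (hφ k).1).add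
      (measurable_MA_sigmaUpTo le_rfl (hG r).1)
  have key : ∀ r ≤ m, ∫ ω, Real.exp (lam * Φ r ω) ∂Pr ≤
      Real.exp (lam ^ 2 * ∑ k ∈ Finset.range r, 2 ^ k * (4 * w (k + 1)) + |lam| * B) := by
    intro r
    induction r with
    | zero =>
      intro _
      have hbd : ∀ ω, Real.exp (lam * Φ 0 ω) ≤ Real.exp (|lam| * B) := fun ω => by
        refine Real.exp_le_exp.2 ((le_abs_self _).trans ?_)
        rw [abs_mul]
        refine mul_le_mul_of_nonneg_left ?_ (abs_nonneg _)
        simpa [hΦ, MA, gen_zero] using hB 0 (X [] ω)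
      refine (integral_mono (((hΦb 0).const_mul lam).exp.integrable Pr)
        (integrable_const _) hbd).trans ?_
      simp
    | succ r ih =>
      intro hr
      set g : (Fin d → ℝ) × (Fin d → ℝ) × (Fin d → ℝ) → ℝ := fun q =>
        Real.exp (lam * (G (r + 1) q.2.1 + G (r + 1) q.2.2 - 2 * Qop P (G (r + 1)) q.1)) with hg
      have hgb : BddMeasurable g := by
        have h1 := (hG (r + 1)).pair.comp
          (measurable_snd (α := Fin d → ℝ) (β := (Fin d → ℝ) × (Fin d → ℝ)))
        have h2 := (((hG (r + 1)).Qop P).const_mul 2).comp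
          (measurable_fst (α := Fin d → ℝ) (β := (Fin d → ℝ) × (Fin d → ℝ)))
        exact ((h1.sub h2).const_mul lam).exp
      have hstep : ∀ ω, Real.exp (lam * Φ (r + 1) ω) = Real.exp (lam * Φ r ω) *
          ∏ i ∈ gen r, g (X i ω, X (i ++ [false]) ω, X (i ++ [true]) ω) := by
        intro ω
        simp only [hg, ← Real.exp_sum, ← Real.exp_add, ← Finset.mul_sum, ← mul_add]
        congr 2
        simp only [hΦ, MA, Finset.sum_range_succ, sum_gen_succ, hrec r (by omega),
          Finset.sum_add_distrib, Finset.sum_sub_distrib]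
        ring
      simp only [hstep]
      refine (hX.integral_mul_prod_le r ((hΦm r).const_mul lam).exp ((hΦb r).const_mul lam).exp
        (fun ω => (Real.exp_pos _).le) hgb (fun q => (Real.exp_pos _).le)
        (integral_exp_sibling_le P (hG (r + 1)) (hB _) (hw _) hlam)).trans ?_
      refine (mul_le_mul_of_nonneg_left (ih (by omega)) (by positivity)).trans (le_of_eq ?_)
      rw [← Real.exp_nat_mul, ← Real.exp_add, Finset.sum_range_succ]
      congr 1
      push_cast
      ring
  simpa [hΦ, MA, hGm] using key m le_rfl

end ExponentialMoment

section Compensator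

/-- The solution of `G r = φ r + 2 Q G (r+1)`, `G m = 0`. -/
def compensator (P : Kernel (Fin d → ℝ) ((Fin d → ℝ) × (Fin d → ℝ)))
    (φ : ℕ → (Fin d → ℝ) → ℝ) (m r : ℕ) (x : Fin d → ℝ) : ℝ :=
  ∑ j ∈ Finset.range (m - r), 2 ^ j * (Qop P)^[j] (φ (r + j)) x

variable {P : Kernel (Fin d → ℝ) ((Fin d → ℝ) × (Fin d → ℝ))}
  {φ : ℕ → (Fin d → ℝ) → ℝ} {m : ℕ}

lemma compensator_eq_add {r : ℕ} (hr : r < m) (x : Fin d → ℝ) :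
    compensator P φ m r x =
      φ r x + ∑ j ∈ Finset.range (m - (r + 1)),
        2 ^ (j + 1) * (Qop P)^[j + 1] (φ (r + 1 + j)) x := by
  rw [compensator, show m - r = m - (r + 1) + 1 by omega, Finset.sum_range_succ', add_comm]
  simp only [pow_zero, one_mul, add_zero, Function.iterate_zero, id_eq, add_assoc, add_comm 1]

variable [IsMarkovKernel P]

lemma BddMeasurable.compensator (hφ : ∀ k, BddMeasurable (φ k)) (r : ℕ) :
    BddMeasurable (compensator P φ m r) :=
  .sum fun j _ => ((hφ _).Qop_iterate P j).const_mul _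

lemma compensator_rec (hφ : ∀ k, BddMeasurable (φ k)) {r : ℕ} (hr : r < m) (x : Fin d → ℝ) :
    compensator P φ m r x = φ r x + 2 * Qop P (compensator P φ m (r + 1)) x := by
  have hQ : Qop P (compensator P φ m (r + 1)) x = ∑ j ∈ Finset.range (m - (r + 1)),
      Qop P (fun y => 2 ^ j * (Qop P)^[j] (φ (r + 1 + j)) y) x :=
    Qop_sum P (fun j _ => ((hφ _).Qop_iterate P j).const_mul _) x
  rw [compensator_eq_add hr, hQ, Finset.mul_sum]
  congr 1
  refine Finset.sum_congr rfl fun j _ => ?_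
  rw [Qop_const_mul, Function.iterate_succ_apply']
  ring


variable {μm : Measure (Fin d → ℝ)} {M α ρ C H : ℝ}

lemma abs_Qop_iterate_succ_le (hinv : IsInvariantQ P μm) (herg : ErgodicQ P μm M α)
    (hM : 0 ≤ M) (hα : 0 ≤ α) (hαρ : α ≤ ρ / 2) {f : (Fin d → ℝ) → ℝ} (hf : BddMeasurable f)
    (hμ : ∫ y, f y ∂μm = 0) (hQ : ∀ x, |Qop P f x| ≤ C) (j : ℕ) (x : Fin d → ℝ) :
    |(Qop P)^[j + 1] f x| ≤ M * (ρ / 2) ^ j * C := by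
  have h := herg (Qop P f) C (hf.Qop P).1 hQ j x
  rw [hinv f hf.1 hf.2, hμ, sub_zero] at h
  have hC : 0 ≤ C := (abs_nonneg _).trans (hQ x)
  rw [Function.iterate_succ_apply]
  refine h.trans ?_
  gcongr

lemma abs_compensator_sub_le (hinv : IsInvariantQ P μm) (herg : ErgodicQ P μm M α)
    (hM : 0 ≤ M) (hα : 0 ≤ α) (hαρ : α ≤ ρ / 2) (hρ1 : 1 < ρ)
    (hφ : ∀ k, BddMeasurable (φ k)) (hμ : ∀ k, ∫ y, φ k y ∂μm = 0)
    (hQ : ∀ k x, |Qop P (φ k) x| ≤ C) {r : ℕ} (hr : r < m) (x : Fin d → ℝ) :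
    |compensator P φ m r x - φ r x| ≤ 2 * M * C / (ρ - 1) * ρ ^ (m - (r + 1)) := by
  have hC : 0 ≤ C := (abs_nonneg _).trans (hQ 0 x)
  rw [compensator_eq_add hr, add_sub_cancel_left]
  have hterm : ∀ j ∈ Finset.range (m - (r + 1)),
      |2 ^ (j + 1) * (Qop P)^[j + 1] (φ (r + 1 + j)) x| ≤ 2 * M * C * ρ ^ j := fun j _ => by
    rw [abs_mul, abs_of_nonneg (by positivity)]
    refine (mul_le_mul_of_nonneg_left (abs_Qop_iterate_succ_le hinv herg hM hα hαρ (hφ _) (hμ _)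
      (hQ _) j x) (by positivity)).trans_eq ?_
    rw [div_pow, pow_succ]
    field_simp
  refine (Finset.abs_sum_le_sum_abs _ _).trans ((Finset.sum_le_sum hterm).trans ?_)
  rw [← Finset.mul_sum, geom_sum_eq hρ1.ne', div_mul_eq_mul_div, ← mul_div_assoc]
  have : 0 < ρ - 1 := by linarith
  gcongr
  linarith

lemma abs_compensator_le (hinv : IsInvariantQ P μm) (herg : ErgodicQ P μm M α)
    (hM : 0 ≤ M) (hα : 0 ≤ α) (hαρ : α ≤ ρ / 2) (hρ1 : 1 < ρ) (hC : 0 ≤ C) (hH : 0 < H)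
    (hHρ : H ^ 2 * ρ ^ m ≤ 1)
    (hφ : ∀ k, BddMeasurable (φ k)) (hμ : ∀ k, ∫ y, φ k y ∂μm = 0)
    (hsup : ∀ k x, |φ k x| ≤ C / H) (hQ : ∀ k x, |Qop P (φ k) x| ≤ C * H)
    (r : ℕ) (x : Fin d → ℝ) :
    |compensator P φ m r x| ≤ (C + 2 * M * C / (ρ - 1)) / H := by
  have hρ : 0 < ρ - 1 := by linarith
  rcases lt_or_ge r m with hr | hr
  · have h := abs_compensator_sub_le hinv herg hM hα hαρ hρ1 hφ hμ hQ hr x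
    have hpow : H * ρ ^ (m - (r + 1)) ≤ 1 / H := by
      rw [le_div_iff₀ hH]
      have : ρ ^ (m - (r + 1)) ≤ ρ ^ m := pow_le_pow_right₀ hρ1.le (by omega)
      nlinarith [mul_le_mul_of_nonneg_left this (sq_nonneg H)]
    have h2 : 2 * M * (C * H) / (ρ - 1) * ρ ^ (m - (r + 1)) ≤ 2 * M * C / (ρ - 1) * (1 / H) := by
      refine (le_of_eq ?_).trans (mul_le_mul_of_nonneg_left hpow (by positivity))
      ring
    have h3 := abs_sub_abs_le_abs_sub (compensator P φ m r x) (φ r x)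
    rw [add_div, ← mul_one_div (2 * M * C / (ρ - 1)) H]
    linarith [hsup r x]
  · rw [compensator, Nat.sub_eq_zero_of_le hr, Finset.range_zero, Finset.sum_empty, abs_zero]
    positivity

lemma Qop_sq_compensator_le (hinv : IsInvariantQ P μm) (herg : ErgodicQ P μm M α)
    (hM : 0 ≤ M) (hα : 0 ≤ α) (hαρ : α ≤ ρ / 2) (hρ1 : 1 < ρ) (hC : 0 ≤ C)
    (hHρ : H ^ 2 * ρ ^ m ≤ 1)
    (hφ : ∀ k, BddMeasurable (φ k)) (hμ : ∀ k, ∫ y, φ k y ∂μm = 0)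
    (hQ : ∀ k x, |Qop P (φ k) x| ≤ C * H) (hQ2 : ∀ k x, Qop P (fun y => φ k y ^ 2) x ≤ C)
    (r : ℕ) (x : Fin d → ℝ) :
    Qop P (fun y => compensator P φ m r y ^ 2) x ≤
      2 * C + 2 * (2 * M * C / (ρ - 1)) ^ 2 * ρ ^ (m - r) := by
  have hρ : 0 < ρ - 1 := by linarith
  have hρ0 : 0 < ρ := by linarith
  rcases lt_or_ge r m with hr | hr
  · set K := 2 * M * C / (ρ - 1) with hK
    set c := 2 * K ^ 2 * ρ ^ (m - r) with hc
    have hpt : ∀ y, compensator P φ m r y ^ 2 ≤ 2 * φ r y ^ 2 + c := fun y => by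
      have h := abs_compensator_sub_le hinv herg hM hα hαρ hρ1 hφ hμ hQ hr y
      have hKH : 2 * M * (C * H) / (ρ - 1) * ρ ^ (m - (r + 1)) =
        K * (H * ρ ^ (m - (r + 1))) := by rw [hK]; ring
      rw [hKH] at h
      have hsq := sq_le_sq' (abs_le.1 h).1 (abs_le.1 h).2
      have hp1 : ρ ^ (m - (r + 1)) ≤ ρ ^ m := pow_le_pow_right₀ hρ1.le (by omega)
      have hp2 : ρ ^ (m - (r + 1)) ≤ ρ ^ (m - r) := pow_le_pow_right₀ hρ1.le (by omega)
      have hp0 : 0 ≤ ρ ^ (m - (r + 1)) := by positivity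
      have hbd : (H * ρ ^ (m - (r + 1))) ^ 2 ≤ ρ ^ (m - r) :=
        calc (H * ρ ^ (m - (r + 1))) ^ 2
            = H ^ 2 * ρ ^ (m - (r + 1)) * ρ ^ (m - (r + 1)) := by ring
          _ ≤ H ^ 2 * ρ ^ m * ρ ^ (m - (r + 1)) := by gcongr
          _ ≤ 1 * ρ ^ (m - r) := by gcongr
          _ = ρ ^ (m - r) := one_mul _
      have hcb : (K * (H * ρ ^ (m - (r + 1)))) ^ 2 ≤ K ^ 2 * ρ ^ (m - r) := by
        rw [mul_pow]; gcongr
      nlinarith [sq_nonneg (compensator P φ m r y - 2 * φ r y)]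
    have h2 : BddMeasurable fun y => 2 * φ r y ^ 2 := (hφ r).sq.const_mul 2
    refine (Qop_mono P (BddMeasurable.compensator hφ r).sq (h2.add (.const c)) hpt x).trans ?_
    rw [Qop_add P h2 (.const c), Qop_const_mul, Qop_const]
    linarith [hQ2 r x]
  · have h0 : (fun y => compensator P φ m r y ^ 2) = fun _ => 0 := by
      ext y
      simp [compensator, Nat.sub_eq_zero_of_le hr]
    rw [h0, Qop_const]
    positivity

end Compensator

lemma sum_two_pow_mul_le {ρ C D : ℝ} (hρ0 : 0 ≤ ρ) (hρ2 : ρ < 2) (hC : 0 ≤ C) (hD : 0 ≤ D)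
    (m : ℕ) :
    ∑ r ∈ Finset.range m, (2 : ℝ) ^ r * (C + D * ρ ^ (m - (r + 1))) ≤
      (C + D / (2 - ρ)) * 2 ^ m := by
  have hρ : 0 < 2 - ρ := by linarith
  have h1 : ∑ r ∈ Finset.range m, (2 : ℝ) ^ r ≤ 2 ^ m := by
    rw [geom_sum_eq (by norm_num)]
    norm_num
  have h2 : ∑ r ∈ Finset.range m, (2 : ℝ) ^ r * ρ ^ (m - (r + 1)) ≤ 2 ^ m / (2 - ρ) := by
    rw [le_div_iff₀ hρ]
    have := geom_sum₂_mul (2 : ℝ) ρ m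
    simp only [Nat.sub_sub, add_comm 1] at this
    rw [this]
    linarith [pow_nonneg hρ0 m]
  calc ∑ r ∈ Finset.range m, (2 : ℝ) ^ r * (C + D * ρ ^ (m - (r + 1)))
      = C * ∑ r ∈ Finset.range m, (2 : ℝ) ^ r +
        D * ∑ r ∈ Finset.range m, (2 : ℝ) ^ r * ρ ^ (m - (r + 1)) := by
        rw [Finset.mul_sum, Finset.mul_sum, ← Finset.sum_add_distrib]
        exact Finset.sum_congr rfl fun _ _ => by ring
    _ ≤ C * 2 ^ m + D * (2 ^ m / (2 - ρ)) := by gcongr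
    _ = (C + D / (2 - ρ)) * 2 ^ m := by ring

/-- Two-sided Bernstein-type tail bound from a sub-exponential moment bound. -/
lemma measure_le_abs_le_of_integral_exp_le {Ω : Type*} [MeasurableSpace Ω] {Pr : Measure Ω}
    [IsProbabilityMeasure Pr] {S : Ω → ℝ} (hS : BddMeasurable S) {A V D t : ℝ} (hA : 0 < A)
    (hV : 0 < V) (ht : 0 < t)
    (h : ∀ lam, |lam| * A ≤ 1 → ∫ ω, Real.exp (lam * S ω) ∂Pr ≤ D * Real.exp (lam ^ 2 * V)) :
    Pr {ω | t ≤ |S ω|} ≤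
      ENNReal.ofReal (2 * D * Real.exp (-(t ^ 2 / (2 * (A * t + 2 * V))))) := by
  have hden : 0 < A * t + 2 * V := by positivity
  set lam := t / (A * t + 2 * V) with hlam
  have hlam0 : 0 < lam := by positivity
  have hmul : lam * (A * t + 2 * V) = t := div_mul_cancel₀ _ hden.ne'
  have hlamA : lam * A ≤ 1 := by
    rw [hlam, div_mul_eq_mul_div, div_le_one hden]
    linarith
  have hexpo : -lam * t + lam ^ 2 * V ≤ -(t ^ 2 / (2 * (A * t + 2 * V))) := by
    have e1 : t ^ 2 / (2 * (A * t + 2 * V)) = lam * t / 2 := by rw [hlam]; field_simp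
    have e2 : lam * V ≤ t / 2 := by nlinarith [mul_pos (mul_pos hlam0 hA) ht]
    rw [e1]
    nlinarith
  have hD : 0 ≤ D := by
    have h0 := h 0 (by simp)
    simp only [zero_mul, Real.exp_zero, integral_const, probReal_univ, one_smul] at h0
    simp only [ne_eq, OfNat.ofNat_ne_zero, not_false_eq_true, zero_pow, zero_mul, Real.exp_zero,
      mul_one] at h0
    linarith
  have hint : ∀ c : ℝ, Integrable (fun ω => Real.exp (c * S ω)) Pr := fun c =>
    (hS.const_mul c).exp.integrable Pr
  have hfinal : Real.exp (-lam * t) * (D * Real.exp (lam ^ 2 * V)) ≤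
      D * Real.exp (-(t ^ 2 / (2 * (A * t + 2 * V)))) := by
    rw [mul_left_comm, ← Real.exp_add]
    gcongr
  have hup : Pr.real {ω | t ≤ S ω} ≤ D * Real.exp (-(t ^ 2 / (2 * (A * t + 2 * V)))) :=
    ((measure_ge_le_exp_mul_mgf t hlam0.le (hint lam)).trans (mul_le_mul_of_nonneg_left
      (h lam (by rwa [abs_of_pos hlam0])) (Real.exp_pos _).le)).trans hfinal
  have hlow : Pr.real {ω | S ω ≤ -t} ≤ D * Real.exp (-(t ^ 2 / (2 * (A * t + 2 * V)))) := by
    have h1 := measure_le_le_exp_mul_mgf (μ := Pr) (-t) (neg_nonpos.2 hlam0.le) (hint (-lam))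
    rw [neg_mul_neg] at h1
    have h2 := h (-lam) (by rwa [abs_neg, abs_of_pos hlam0])
    rw [neg_sq] at h2
    exact (h1.trans (mul_le_mul_of_nonneg_left h2 (Real.exp_pos _).le)).trans hfinal
  have hsub : {ω | t ≤ |S ω|} ⊆ {ω | t ≤ S ω} ∪ {ω | S ω ≤ -t} := fun ω hω => by
    rcases le_abs.1 (show t ≤ |S ω| from hω) with h' | h'
    · exact .inl h'
    · exact .inr (by simp only [Set.mem_ofPred_eq]; linarith)
  have hreal : Pr.real {ω | t ≤ |S ω|} ≤
      2 * D * Real.exp (-(t ^ 2 / (2 * (A * t + 2 * V)))) := by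
    refine (measureReal_mono hsub).trans ((measureReal_union_le _ _).trans ?_)
    linarith
  rw [← ofReal_measureReal]
  exact ENNReal.ofReal_le_ofReal hreal

section Tilde

variable {P : Kernel (Fin d → ℝ) ((Fin d → ℝ) × (Fin d → ℝ))}
  {μm : Measure (Fin d → ℝ)} {f : (Fin d → ℝ) → ℝ} {C : ℝ}

lemma BddMeasurable.tilde (hf : BddMeasurable f) : BddMeasurable (tilde μm f) :=
  hf.sub (.const _)

lemma integral_tilde [IsProbabilityMeasure μm] (hf : BddMeasurable f) : ∫ x, tilde μm f x ∂μm = 0 := by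
  simp only [BMC.tilde]
  rw [integral_sub (hf.integrable _) (integrable_const _)]
  simp

lemma abs_integral_le_of_abs_Qop_le [IsProbabilityMeasure μm] (hinv : IsInvariantQ P μm) (hf : BddMeasurable f)
    (hQ : ∀ x, |Qop P f x| ≤ C) :
    |∫ x, f x ∂μm| ≤ C := by
  rw [← hinv f hf.1 hf.2]
  simpa using norm_integral_le_of_norm_le_const (μ := μm) (f := Qop P f) (ae_of_all _ hQ)

variable [IsMarkovKernel P]

lemma Qop_tilde (hf : BddMeasurable f) (x : Fin d → ℝ) :
    Qop P (tilde μm f) x = Qop P f x - ∫ y, f y ∂μm := by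
  have := Qop_add P hf (.const (-∫ y, f y ∂μm)) x
  rwa [Qop_const] at this

lemma Qop_sq_tilde_le (hf : BddMeasurable f) (x : Fin d → ℝ) :
    Qop P (fun y => tilde μm f y ^ 2) x ≤
      2 * Qop P (fun y => f y ^ 2) x + 2 * (∫ y, f y ∂μm) ^ 2 := by
  have h2 : BddMeasurable fun y => 2 * f y ^ 2 := hf.sq.const_mul 2
  have hpt : ∀ y, tilde μm f y ^ 2 ≤ 2 * f y ^ 2 + 2 * (∫ y, f y ∂μm) ^ 2 := fun y => by
    rw [BMC.tilde]
    nlinarith [sq_nonneg (f y + ∫ y, f y ∂μm)]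
  refine (Qop_mono P hf.tilde.sq (h2.add (.const _)) hpt x).trans_eq ?_
  rw [Qop_add P h2 (.const _), Qop_const_mul, Qop_const]

end Tilde

lemma bandwidth_pos (γ : ℝ) (n : ℕ) : 0 < bandwidth γ n := Real.rpow_pos_of_pos two_pos _

lemma bandwidth_rpow_sq_mul (γ : ℝ) (n d : ℕ) :
    (bandwidth γ n ^ ((d : ℝ) / 2)) ^ 2 * ((2 : ℝ) ^ ((d : ℝ) * γ)) ^ n = 1 := by
  rw [bandwidth, ← Real.rpow_mul zero_le_two, ← Real.rpow_natCast, ← Real.rpow_natCast,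
    ← Real.rpow_mul zero_le_two, ← Real.rpow_mul zero_le_two, ← Real.rpow_add two_pos,
    ← Real.rpow_zero 2]
  congr 1
  push_cast
  ring

lemma le_half_rpow_of_tendsto {α θ : ℝ} (hθ : 0 ≤ θ)
    (h : 1 / 2 < α → Tendsto (fun n : ℕ => ((2 : ℝ) ^ (1 - θ) * α) ^ n) atTop (nhds 0)) :
    α ≤ (2 : ℝ) ^ θ / 2 := by
  by_contra! hlt
  have h1 : 1 ≤ (2 : ℝ) ^ θ := Real.one_le_rpow one_le_two hθ
  have hge : 1 ≤ (2 : ℝ) ^ (1 - θ) * α := by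
    rw [Real.rpow_sub two_pos, Real.rpow_one, div_mul_eq_mul_div, le_div_iff₀ (by linarith)]
    linarith
  have := ge_of_tendsto' (h (by linarith)) fun n => one_le_pow₀ (n := n) hge
  linarith

/-- Sub-exponential moment bound for the sum over the generations `k < m ≤ n` of
`M_{G_k}(f̃_{n-k,n})`. -/
lemma exists_integral_exp_sum_MA_tilde_le
    {d : ℕ} (hd : 1 ≤ d)
    {Ω : Type*} [MeasurableSpace Ω] {Pr : Measure Ω} [IsProbabilityMeasure Pr]
    {X : Word → Ω → (Fin d → ℝ)} {ν : Measure (Fin d → ℝ)}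
    {P : Kernel (Fin d → ℝ) ((Fin d → ℝ) × (Fin d → ℝ))} [IsMarkovKernel P]
    (hBMC : IsBMC Pr X ν P)
    {μm : Measure (Fin d → ℝ)} [IsProbabilityMeasure μm] (hinv : IsInvariantQ P μm)
    {M α : ℝ} (hM : 0 < M) (hα0 : 0 < α) (herg : ErgodicQ P μm M α)
    {γ : ℝ} (hγ0 : 0 < γ) (hγd : γ < 1 / (d : ℝ))
    {f : ℕ → ℕ → (Fin d → ℝ) → ℝ} {σ2 : ℝ} (hf : FnAssump P μm γ f σ2)
    (hα2 : 1 / 2 < α →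
      Tendsto (fun n : ℕ => ((2 : ℝ) ^ (1 - (d : ℝ) * γ) * α) ^ n) atTop (nhds 0)) :
    ∃ A W : ℝ, 0 < A ∧ 0 < W ∧ ∀ n m : ℕ, m ≤ n →
      BddMeasurable (fun ω => ∑ k ∈ Finset.range m, MA X (gen k) (tilde μm (f n (n - k))) ω) ∧
      ∀ lam : ℝ, |lam| * (A / bandwidth γ n ^ ((d : ℝ) / 2)) ≤ 1 →
        ∫ ω, Real.exp (lam * ∑ k ∈ Finset.range m,
          MA X (gen k) (tilde μm (f n (n - k))) ω) ∂Pr ≤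
            Real.exp 1 * Real.exp (lam ^ 2 * (W * 2 ^ m)) := by
  obtain ⟨hfm, -, ⟨C, hC⟩, -, -⟩ := hf
  have hd0 : (0 : ℝ) < d := by exact_mod_cast hd
  have hθ0 : 0 < (d : ℝ) * γ := by positivity
  have hθ1 : (d : ℝ) * γ < 1 := by
    rw [lt_div_iff₀ hd0] at hγd
    linarith
  set ρ : ℝ := 2 ^ ((d : ℝ) * γ) with hρ
  have hρ1 : 1 < ρ := Real.one_lt_rpow one_lt_two hθ0
  have hρ2 : ρ < 2 := by
    simpa using Real.rpow_lt_rpow_of_exponent_lt one_lt_two hθ1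
  have hρ1' : 0 < ρ - 1 := by linarith
  have hρ2' : 0 < 2 - ρ := by linarith
  have hαρ : α ≤ ρ / 2 := le_half_rpow_of_tendsto hθ0.le hα2
  have hC0 : 0 ≤ C := (abs_nonneg _).trans ((hC 0 0 le_rfl).2.2.1 0)
  set D := 2 * C + 2 * C ^ 2 + 1 with hD
  have hD0 : 0 < D := by positivity
  set K := 2 * M * D / (ρ - 1) with hK
  have hK0 : 0 < K := by positivity
  set W := 8 * D + 8 * K ^ 2 / (2 - ρ) with hW
  have hW0 : 0 < W := by positivity
  refine ⟨4 * (D + K), W, by positivity, hW0, fun n m hmn => ?_⟩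
  set H := bandwidth γ n ^ ((d : ℝ) / 2) with hH
  have hH0 : 0 < H := Real.rpow_pos_of_pos (bandwidth_pos γ n) _
  have hHρ : H ^ 2 * ρ ^ n = 1 := bandwidth_rpow_sq_mul γ n d
  have hH1 : H ≤ 1 := by
    have : 1 ≤ ρ ^ n := one_le_pow₀ hρ1.le
    have : H ^ 2 ≤ 1 := by nlinarith [mul_le_mul_of_nonneg_left this (sq_nonneg H)]
    nlinarith
  have hHρm : H ^ 2 * ρ ^ m ≤ 1 := by
    rw [← hHρ]
    gcongr
    exact hρ1.le
  set φ : ℕ → (Fin d → ℝ) → ℝ := fun k => tilde μm (f n (n - k)) with hφ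
  have hfsup : ∀ ℓ ≤ n, ∀ x, |f n ℓ x| ≤ C / H := fun ℓ hℓ x => by
    rw [le_div_iff₀ hH0, mul_comm]
    exact (hC n ℓ hℓ).1 x
  have hfb : ∀ k, BddMeasurable (f n (n - k)) := fun k =>
    ⟨hfm _ _, C / H, hfsup _ (Nat.sub_le _ _)⟩
  have hfμ : ∀ k, |∫ y, f n (n - k) y ∂μm| ≤ C * H := fun k =>
    abs_integral_le_of_abs_Qop_le hinv (hfb k) (hC n _ (Nat.sub_le _ _)).2.1
  have hφb : ∀ k, BddMeasurable (φ k) := fun k => (hfb k).tilde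
  have hφμ : ∀ k, ∫ y, φ k y ∂μm = 0 := fun k => integral_tilde (hfb k)
  have hφsup : ∀ k x, |φ k x| ≤ D / H := fun k x => by
    have h1 := hfsup _ (Nat.sub_le n k) x
    have h2 : C * H ≤ C / H := by
      rw [le_div_iff₀ hH0]
      nlinarith [mul_le_mul_of_nonneg_left (show H * H ≤ 1 by nlinarith) hC0]
    have h3 : 2 * C / H ≤ D / H := by
      gcongr
      nlinarith [sq_nonneg C]
    refine (abs_sub _ _).trans ?_
    rw [two_mul, add_div] at h3
    linarith [hfμ k]
  have hφQ : ∀ k x, |Qop P (φ k) x| ≤ D * H := fun k x => by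
    have h1 := (hC n _ (Nat.sub_le n k)).2.1 x
    have h3 : 2 * C * H ≤ D * H := by
      gcongr
      nlinarith [sq_nonneg C]
    rw [hφ, Qop_tilde (hfb k)]
    refine (abs_sub _ _).trans ?_
    linarith [hfμ k]
  have hφQ2 : ∀ k x, Qop P (fun y => φ k y ^ 2) x ≤ D := fun k x => by
    have h1 := (le_abs_self _).trans ((hC n _ (Nat.sub_le n k)).2.2.1 x)
    have h2 : (∫ y, f n (n - k) y ∂μm) ^ 2 ≤ C ^ 2 := by
      rw [← sq_abs]
      exact pow_le_pow_left₀ (abs_nonneg _) ((hfμ k).trans (by nlinarith)) 2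
    refine (Qop_sq_tilde_le (hfb k) x).trans ?_
    linarith
  refine ⟨.sum fun k _ => (hφb k).MA hBMC.meas _, ?_⟩
  intro lam hlam
  rw [mul_div_assoc] at hlam
  refine (hBMC.integral_exp_sum_MA_le hφb (fun r => BddMeasurable.compensator (m := m) hφb r)
    (fun r hr x => compensator_rec hφb hr x) (fun x => by simp [compensator])
    (abs_compensator_le hinv herg hM.le hα0.le hαρ hρ1 hD0.le hH0 hHρm hφb hφμ hφsup hφQ)
    (Qop_sq_compensator_le hinv herg hM.le hα0.le hαρ hρ1 hD0.le hHρm hφb hφμ hφQ hφQ2)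
    hlam).trans ?_
  have hsum := sum_two_pow_mul_le (C := 8 * D) (D := 8 * K ^ 2) (by linarith) hρ2
    (by positivity) (by positivity) m
  rw [← Real.exp_add, Real.exp_le_exp, add_comm]
  refine add_le_add ?_ (mul_le_mul_of_nonneg_left ?_ (sq_nonneg lam))
  · have : 0 ≤ |lam| * ((D + K) / H) := by positivity
    linarith
  · refine (Finset.sum_le_sum fun r _ => le_of_eq ?_).trans hsum
    ring

/-- Inequality (5.9): explicit exponential bound for the tail of R₀(n). -/
theorem remainder_R0_exponential_bound
    {d : ℕ} (hd : 1 ≤ d)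
    {Ω : Type*} [MeasurableSpace Ω] (Pr : Measure Ω) [IsProbabilityMeasure Pr]
    (X : Word → Ω → (Fin d → ℝ)) (ν : Measure (Fin d → ℝ)) [IsProbabilityMeasure ν]
    (P : Kernel (Fin d → ℝ) ((Fin d → ℝ) × (Fin d → ℝ))) [IsMarkovKernel P]
    (hBMC : IsBMC Pr X ν P)
    (μm : Measure (Fin d → ℝ)) [IsProbabilityMeasure μm] (hinv : IsInvariantQ P μm)
    (M α : ℝ) (hM : 0 < M) (hα0 : 0 < α) (hα1 : α < 1) (herg : ErgodicQ P μm M α)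
    (γ : ℝ) (hγ0 : 0 < γ) (hγd : γ < 1 / (d : ℝ))
    (f : ℕ → ℕ → (Fin d → ℝ) → ℝ) (σ2 : ℝ) (hf : FnAssump P μm γ f σ2)
    (hα2 : 1 / 2 < α →
      Tendsto (fun n : ℕ => ((2 : ℝ) ^ (1 - (d : ℝ) * γ) * α) ^ n) atTop (nhds 0))
    (s : ℝ) (hs : 0 < s) (b : ℕ → ℝ) (hb : SpeedCond b γ s d)
    (p : ℕ → ℕ) (hp : PCond p b) :
    ∃ C c₁ c₂ : ℝ, 0 < C ∧ 0 < c₁ ∧ 0 < c₂ ∧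
      ∀ δ > (0 : ℝ), ∀ n : ℕ,
        Pr {ω | (b n)⁻¹ * |(Real.sqrt (2 ^ n))⁻¹ *
            ∑ k ∈ Finset.range (n - p n), MA X (gen k) (tilde μm (f n (n - k))) ω| > δ} ≤
          ENNReal.ofReal (2 * C * Real.exp (-(3 * δ ^ 2 * b n ^ 2 * 2 ^ n) /
            (2 * (c₂ * δ * b n * Real.sqrt (2 ^ n) * bandwidth γ n ^ (-(d : ℝ) / 2) +
              3 * c₁ * 2 ^ (n - p n : ℕ))))) := by
  obtain ⟨A, W, hA, hW, hmgf⟩ :=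
    exists_integral_exp_sum_MA_tilde_le hd hBMC hinv hM hα0 herg hγ0 hγd hf hα2
  refine ⟨Real.exp 1, 2 * W, 3 * A, Real.exp_pos 1, by positivity, by positivity, ?_⟩
  intro δ hδ n
  have hbn : 0 < b n := hb.1 n
  obtain ⟨hSb, hS⟩ := hmgf n (n - p n) (Nat.sub_le _ _)
  have hH0 : 0 < bandwidth γ n ^ ((d : ℝ) / 2) := Real.rpow_pos_of_pos (bandwidth_pos γ n) _
  have hsqrt : 0 < Real.sqrt (2 ^ n) := Real.sqrt_pos.2 (by positivity)
  have ht : 0 < δ * b n * Real.sqrt (2 ^ n) := by positivity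
  refine (measure_mono fun ω hω => ?_).trans ((measure_le_abs_le_of_integral_exp_le hSb
    (div_pos hA hH0)
    (mul_pos hW (by positivity)) ht hS).trans_eq ?_)
  · simp only [Set.mem_ofPred_eq, abs_mul, abs_inv, abs_of_pos hsqrt] at hω ⊢
    rw [gt_iff_lt, lt_inv_mul_iff₀ hbn, lt_inv_mul_iff₀ hsqrt] at hω
    refine le_trans (le_of_eq ?_) hω.le
    ring
  · have hsq : 3 * δ ^ 2 * b n ^ 2 * 2 ^ n = 3 * (δ * b n * Real.sqrt (2 ^ n)) ^ 2 := by
      rw [mul_pow, Real.sq_sqrt (by positivity)]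
      ring
    rw [hsq, neg_div 2 (d : ℝ), Real.rpow_neg (bandwidth_pos γ n).le, neg_div]
    congr 4
    field_simp

end BMC
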